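/- In the quotient ring A = k⟨a,b⟩/(ab+ba, a² + b^{2n+1} + Σ_{i=1}^{2n} λᵢ b^{2i}), where k is a field of characteristic 0, n ≥ 1, and λ₁,…,λ_{2n} ∈ k, the relations a·b^{2n+1} = 0 and t·a·b = t·b·a = 0 hold, where t denotes b^{2n}. -/

import Mathlib

noncomputable section

open scoped BigOperators

variable {k : Type*} [Field k] [CharZero k]

/-- Generators of the free algebra k⟨a,b⟩. -/
def Fa (k : Type*) [Field k] : FreeAlgebra k (Fin 2) := FreeAlgebra.ι k 0
def Fb (k : Type*) [Field k] : FreeAlgebra k (Fin 2) := FreeAlgebra.ι k 1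

/-- The relation generating the two-sided ideal: ab+ba and
a² + b^{2n+1} + Σ_{i=1}^{2n} λᵢ b^{2i}. -/
inductive LauferRel (k : Type*) [Field k] (n : ℕ) (lam : ℕ → k) :
    FreeAlgebra k (Fin 2) → FreeAlgebra k (Fin 2) → Prop
  | anticomm : LauferRel k n lam (Fa k * Fb k + Fb k * Fa k) 0
  | equation : LauferRel k n lam
      (Fa k ^ 2 + Fb k ^ (2*n+1) + ∑ i ∈ Finset.Icc 1 (2*n), lam i • Fb k ^ (2*i)) 0

/-- The NC deformation algebra A = k⟨a,b⟩/(ab+ba, a²+b^{2n+1}+Σλᵢb^{2i}). -/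
abbrev LauferAlg (k : Type*) [Field k] (n : ℕ) (lam : ℕ → k) := RingQuot (LauferRel k n lam)

def la (k : Type*) [Field k] (n : ℕ) (lam : ℕ → k) : LauferAlg k n lam :=
  RingQuot.mkAlgHom k (LauferRel k n lam) (Fa k)
def lb (k : Type*) [Field k] (n : ℕ) (lam : ℕ → k) : LauferAlg k n lam :=
  RingQuot.mkAlgHom k (LauferRel k n lam) (Fb k)

theorem laufer_aux {K R : Type*} [Field K] [CharZero K] [Ring R] [Algebra K R] (n : ℕ)
    (lam : ℕ → K) (a b : R) (h1 : a * b + b * a = 0)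
    (h2 : a ^ 2 + b ^ (2*n+1) + ∑ i ∈ Finset.Icc 1 (2*n), lam i • b ^ (2*i) = 0) :
    a * b ^ (2*n+1) = 0 ∧ b ^ (2*n) * (a * b) = 0 ∧ b ^ (2*n) * (b * a) = 0 := by
  have hab : a * b = -(b * a) := eq_neg_of_add_eq_zero_left h1
  have hsq : Commute a (b ^ 2) := by
    change a * b ^ 2 = b ^ 2 * a
    rw [pow_two, ← mul_assoc, hab, neg_mul, mul_assoc, hab, mul_neg, neg_neg, mul_assoc]
  have hev : ∀ i, Commute a (b ^ (2*i)) := fun i => by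
    rw [pow_mul]; exact hsq.pow_right i
  have hsum : Commute a (∑ i ∈ Finset.Icc 1 (2*n), lam i • b ^ (2*i)) :=
    Commute.sum_right _ _ _ fun i _ => (hev i).smul_right _
  have hodd : Commute a (b ^ (2*n+1)) := by
    have e : b ^ (2*n+1) = -(a ^ 2 + ∑ i ∈ Finset.Icc 1 (2*n), lam i • b ^ (2*i)) := by
      rw [eq_neg_iff_add_eq_zero, ← h2]; abel
    rw [e]
    exact (((Commute.refl a).pow_right 2).add_right hsum).neg_right
  have hanti : a * b ^ (2*n+1) = -(b ^ (2*n+1) * a) := by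
    rw [pow_succ, ← mul_assoc, (hev n).eq, mul_assoc, hab, mul_neg, mul_assoc]
  have h0 : a * b ^ (2*n+1) = 0 := by
    have h3 : a * b ^ (2*n+1) + a * b ^ (2*n+1) = 0 := by
      nth_rewrite 1 [hanti]
      rw [hodd.eq, neg_add_cancel]
    have h4 : (2 : K) • (a * b ^ (2*n+1)) = 0 := by rw [two_smul, h3]
    exact (smul_eq_zero_iff_right (two_ne_zero)).1 h4
  refine ⟨h0, ?_, ?_⟩
  · rw [← mul_assoc, ← (hev n).eq, mul_assoc, ← pow_succ, h0]
  · rw [← mul_assoc, ← pow_succ, ← hodd.eq, h0]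

theorem laufer_relations (n : ℕ) (hn : 1 ≤ n) (lam : ℕ → k) :
    la k n lam * lb k n lam ^ (2*n+1) = 0 ∧
    lb k n lam ^ (2*n) * (la k n lam * lb k n lam) = 0 ∧
    lb k n lam ^ (2*n) * (lb k n lam * la k n lam) = 0 := by
  have h1 : la k n lam * lb k n lam + lb k n lam * la k n lam = 0 := by
    have := RingQuot.mkAlgHom_rel k (LauferRel.anticomm (k := k) (n := n) (lam := lam))
    simpa [la, lb] using this
  have h2 : la k n lam ^ 2 + lb k n lam ^ (2*n+1)
      + ∑ i ∈ Finset.Icc 1 (2*n), lam i • lb k n lam ^ (2*i) = 0 := by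
    have := RingQuot.mkAlgHom_rel k (LauferRel.equation (k := k) (n := n) (lam := lam))
    simpa only [la, lb, map_add, map_pow, map_sum, map_smul, map_zero] using this
  exact laufer_aux n lam _ _ h1 h2

end
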